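/- arXiv:2109.05291 — 12 statements merged into one kernel-verified Lean document; each statement's English description precedes it below -/
import Mathlib

section
/- Let n, k, l be integers with n ≥ 1, k ≥ 2 and 0 ≤ l ≤ k−2. The number of (k,l)-threshold sequences of length n is equal to the Raney number R_n^{(k,l+1)} = ((l+1)/(kn+l+1))·binom(kn+l+1, n). -/
/-- Strictly increasing integer sequences `s` of length `n` with `k * (i + 1) ≤ s i < M`
for every zero-based index `i`. -/
def boundedThresholdSeqs (k n M : ℕ) : Set (Fin n → ℤ) :=
  {s | StrictMono s ∧ ∀ i : Fin n, (k : ℤ) * (i.1 + 1) ≤ s i ∧ s i < M}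

theorem boundedThresholdSeqs_finite (k n M : ℕ) : (boundedThresholdSeqs k n M).Finite := by
  refine (Set.Finite.pi' fun _ : Fin n => Set.finite_Icc (0 : ℤ) M).subset ?_
  rintro s ⟨-, h⟩ i
  have h0 : (0 : ℤ) ≤ (k : ℤ) * (i.1 + 1) := by positivity
  exact ⟨h0.trans (h i).1, (h i).2.le⟩

theorem boundedThresholdSeqs_zero (k M : ℕ) : (boundedThresholdSeqs k 0 M).ncard = 1 := by
  rw [Set.ncard_eq_one]
  refine ⟨Fin.elim0, Set.eq_singleton_iff_unique_mem.2 ⟨⟨fun i => i.elim0, fun i => i.elim0⟩, ?_⟩⟩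
  intro s _
  exact Subsingleton.elim _ _

theorem boundedThresholdSeqs_diagonal (k n : ℕ) :
    boundedThresholdSeqs k (n + 1) (k * (n + 1)) = ∅ := by
  refine Set.eq_empty_of_forall_notMem ?_
  rintro s ⟨-, h⟩
  have := h (Fin.last n)
  push_cast [Fin.val_last] at this
  lia

theorem boundedThresholdSeqs_succ {k n M : ℕ} (hM : k * (n + 1) ≤ M) :
    boundedThresholdSeqs k (n + 1) (M + 1) =
      boundedThresholdSeqs k (n + 1) M ∪
        (fun s : Fin n → ℤ => Fin.snoc (α := fun _ => ℤ) s (M : ℤ)) ''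
          boundedThresholdSeqs k n M := by
  have hM' : (k : ℤ) * (n + 1) ≤ M := by exact_mod_cast hM
  ext s
  constructor
  · rintro ⟨hs, h⟩
    by_cases hlast : s (Fin.last n) = M
    · right
      refine ⟨Fin.init s, ⟨hs.comp (Fin.strictMono_castSucc), fun i => ⟨(h i.castSucc).1, ?_⟩⟩, ?_⟩
      · rw [← hlast]
        exact hs (Fin.castSucc_lt_last i)
      · simp only [← hlast]
        exact Fin.snoc_init_self s
    · left
      refine ⟨hs, fun i => ⟨(h i).1, ?_⟩⟩
      have h1 := (h (Fin.last n)).2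
      have h2 := hs.monotone (Fin.le_last i)
      push_cast at h1
      lia
  · rintro (⟨hs, h⟩ | ⟨t, ⟨ht, h⟩, rfl⟩)
    · refine ⟨hs, fun i => ⟨(h i).1, ?_⟩⟩
      have := (h i).2
      push_cast
      lia
    · refine ⟨?_, fun i => ?_⟩
      · intro i j hij
        induction j using Fin.lastCases with
        | last =>
          induction i using Fin.lastCases with
          | last => exact absurd hij (lt_irrefl _)
          | cast i => simpa using (h i).2
        | cast j =>
          induction i using Fin.lastCases with
          | last => exact absurd hij (Fin.castSucc_lt_last j).not_gt
          | cast i => simpa using ht (Fin.castSucc_lt_castSucc_iff.1 hij)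
      · induction i using Fin.lastCases with
        | last => simpa using hM'
        | cast i =>
          have h1 := h i
          simp only [Fin.snoc_castSucc, Fin.val_castSucc]
          push_cast
          exact ⟨h1.1, by lia⟩

theorem ncard_boundedThresholdSeqs_succ {k n M : ℕ} (hM : k * (n + 1) ≤ M) :
    (boundedThresholdSeqs k (n + 1) (M + 1)).ncard =
      (boundedThresholdSeqs k (n + 1) M).ncard + (boundedThresholdSeqs k n M).ncard := by
  rw [boundedThresholdSeqs_succ hM, Set.ncard_union_eq ?_ (boundedThresholdSeqs_finite _ _ _)
    ((boundedThresholdSeqs_finite _ _ _).image _), Set.ncard_image_of_injective]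
  · intro s t hst
    simpa using congrArg (Fin.init (α := fun _ => ℤ)) hst
  · rw [Set.disjoint_left]
    rintro _ ⟨-, h⟩ ⟨t, -, rfl⟩
    simpa using (h (Fin.last n)).2

theorem ncard_boundedThresholdSeqs_mul {k : ℕ} (hk : 1 ≤ k) (n M : ℕ) (hM : k * n ≤ M) :
    ((boundedThresholdSeqs k n M).ncard : ℚ) * M = (M - k * n) * M.choose n := by
  induction n generalizing M with
  | zero => simp [boundedThresholdSeqs_zero]
  | succ n ihn =>
    induction M, hM using Nat.le_induction with
    | base => simp [boundedThresholdSeqs_diagonal]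
    | succ M hM ihM =>
      have ih := ihn M ((Nat.mul_le_mul_left k n.le_succ).trans hM)
      have hnM : n + 1 ≤ M := (Nat.le_mul_of_pos_left _ hk).trans hM
      have hM0 : (M : ℚ) ≠ 0 := by
        exact_mod_cast (by lia : M ≠ 0)
      have hc : (M.choose (n + 1) : ℚ) * (n + 1) = M.choose n * (M - n) := by
        rw [← Nat.cast_sub (by lia : n ≤ M)]
        exact_mod_cast Nat.choose_succ_right_eq M n
      rw [ncard_boundedThresholdSeqs_succ hM, Nat.choose_succ_succ]
      push_cast at ihM ⊢
      apply mul_left_cancel₀ hM0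
      linear_combination (M + 1 : ℚ) * ihM + (M + 1 : ℚ) * ih - (k : ℚ) * hc

/-- The number of (k,l)-threshold sequences of length n equals the
Raney number R_n^{(k,l+1)} = ((l+1)/(kn+l+1))·binom(kn+l+1, n). -/
theorem raney_counts_threshold_sequences (n k l : ℕ) (hn : 1 ≤ n) (hk : 2 ≤ k)
    (hl : l ≤ k - 2) :
    (Set.ncard {s : Fin n → ℤ | StrictMono s ∧
        ∀ i : Fin n, (k : ℤ) * (i.1 + 1) ≤ s i ∧ s i ≤ k * n + l} : ℚ) =
      ((l + 1 : ℚ) / (k * n + l + 1)) * Nat.choose (k * n + l + 1) n := by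
  have hset : {s : Fin n → ℤ | StrictMono s ∧
      ∀ i : Fin n, (k : ℤ) * (i.1 + 1) ≤ s i ∧ s i ≤ k * n + l} =
      boundedThresholdSeqs k n (k * n + l + 1) := by
    simp only [boundedThresholdSeqs, Nat.cast_add, Nat.cast_mul, Nat.cast_one, Int.lt_add_one_iff]
  have h := ncard_boundedThresholdSeqs_mul (by lia : 1 ≤ k) n (k * n + l + 1) (by lia)
  have h0 : (k * n + l + 1 : ℚ) ≠ 0 := by positivity
  rw [hset, div_mul_eq_mul_div, eq_div_iff h0]
  push_cast at h
  rw [h]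
  ring
end

section
/- Let n, k, l be integers with n ≥ 1, k ≥ 2 and 1 ≤ l ≤ k−2. The number of proper (k,l)-threshold sequences of length n is equal to the Raney number R_{n−1}^{(k,k+l)} = ((k+l)/((k−1)(n−1)+k+l))·binom(kn+l−1, n−1). -/
/-- Strictly increasing integer sequences of length `m` bounded below by `k, 2k, …, mk`
and strictly above by `N`. -/
def boundedThresholdSeq (k m : ℕ) (N : ℤ) : Set (Fin m → ℤ) :=
  {s | StrictMono s ∧ ∀ i : Fin m, (k : ℤ) * (i.1 + 1) ≤ s i ∧ s i < N}

namespace boundedThresholdSeq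

lemma finite (k m : ℕ) (N : ℤ) : (boundedThresholdSeq k m N).Finite := by
  refine (Set.finite_Icc (fun _ : Fin m => (0 : ℤ)) (fun _ => N)).subset ?_
  rintro s ⟨-, hs⟩
  refine ⟨fun i => ?_, fun i => (hs i).2.le⟩
  have : (0 : ℤ) ≤ (k : ℤ) * (i.1 + 1) := by positivity
  exact this.trans (hs i).1

lemma ncard_zero (k : ℕ) (N : ℤ) : (boundedThresholdSeq k 0 N).ncard = 1 := by
  have : boundedThresholdSeq k 0 N = Set.univ := by
    ext s
    simp [boundedThresholdSeq, Subsingleton.strictMono]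
  rw [this, Set.ncard_univ]
  simp

lemma ncard_succ_of_le (k m : ℕ) (N : ℤ) (h : N ≤ k * (m + 1)) :
    (boundedThresholdSeq k (m + 1) N).ncard = 0 := by
  have : boundedThresholdSeq k (m + 1) N = ∅ := by
    ext s
    simp only [Set.mem_empty_iff_false, iff_false]
    rintro ⟨-, hs⟩
    have := hs (Fin.last m)
    simp only [Fin.val_last] at this
    omega
  rw [this, Set.ncard_empty]

/-- Removing the last term is a bijection from sequences with last term `N`
onto sequences bounded strictly by `N`. -/
lemma ncard_last_eq (k m : ℕ) (N : ℤ) (h : (k : ℤ) * (m + 1) ≤ N) :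
    {s ∈ boundedThresholdSeq k (m + 1) (N + 1) | s (Fin.last m) = N}.ncard =
      (boundedThresholdSeq k m N).ncard := by
  symm
  refine Set.ncard_congr (fun s _ => Fin.snoc (α := fun _ => ℤ) s N) ?_ ?_ ?_
  · rintro s ⟨hs, hb⟩
    refine ⟨⟨?_, ?_⟩, by simp⟩
    · intro i j hij
      induction j using Fin.lastCases with
      | last =>
        induction i using Fin.lastCases with
        | last => exact absurd hij (lt_irrefl _)
        | cast i => simpa using (hb i).2
      | cast j =>
        induction i using Fin.lastCases with
        | last => exact absurd hij (not_lt.mpr (Fin.le_last _))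
        | cast i => simpa using hs (Fin.castSucc_lt_castSucc_iff.mp hij)
    · intro i
      induction i using Fin.lastCases with
      | last => simpa using h
      | cast i => simpa using ⟨(hb i).1, (hb i).2.le⟩
  · intro s t _ _ hst
    exact (Fin.snoc_injective2 hst).1
  · rintro s ⟨⟨hs, hb⟩, hlast⟩
    refine ⟨Fin.init s, ⟨?_, ?_⟩, ?_⟩
    · exact fun i j hij => hs (Fin.castSucc_lt_castSucc_iff.mpr hij)
    · intro i
      exact ⟨(hb i.castSucc).1, hlast ▸ hs (Fin.castSucc_lt_last i)⟩
    · rw [← hlast]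
      exact Fin.snoc_init_self s

lemma ncard_succ_succ (k m : ℕ) (N : ℤ) (h : (k : ℤ) * (m + 1) ≤ N) :
    (boundedThresholdSeq k (m + 1) (N + 1)).ncard =
      (boundedThresholdSeq k (m + 1) N).ncard + (boundedThresholdSeq k m N).ncard := by
  rw [← ncard_last_eq k m N h, ← Set.ncard_union_eq ?_ (finite k (m + 1) N)
    ((finite k (m + 1) (N + 1)).subset (Set.sep_subset _ _))]
  · congr 1
    ext s
    constructor
    · rintro ⟨hs, hb⟩
      rcases (Int.lt_add_one_iff.mp (hb (Fin.last m)).2).lt_or_eq with hlt | heq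
      · exact Or.inl ⟨hs, fun i => ⟨(hb i).1, (hs.monotone (Fin.le_last i)).trans_lt hlt⟩⟩
      · exact Or.inr ⟨⟨hs, hb⟩, heq⟩
    · rintro (⟨hs, hb⟩ | ⟨hs, -⟩)
      · exact ⟨hs, fun i => ⟨(hb i).1, (hb i).2.trans (lt_add_one N)⟩⟩
      · exact hs
  · rw [Set.disjoint_left]
    rintro s ⟨-, hb⟩ ⟨-, hlast⟩
    exact (hb (Fin.last m)).2.ne hlast

/-- A ballot-type closed form for the number of bounded threshold sequences. -/
lemma ncard_succ (k : ℕ) (hk : 1 ≤ k) (N m : ℕ) (h : k * (m + 1) ≤ N + 1) :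
    ((boundedThresholdSeq k (m + 1) ((N : ℤ) + 1)).ncard : ℤ) =
      (N + 1).choose (m + 1) - k * N.choose m := by
  induction N generalizing m with
  | zero =>
    have hm : m = 0 ∧ k = 1 := by constructor <;> nlinarith
    obtain ⟨rfl, rfl⟩ := hm
    rw [ncard_succ_of_le _ _ _ (by simp)]
    simp
  | succ N ih =>
    rcases h.eq_or_lt with heq | hlt
    · rw [ncard_succ_of_le _ _ _ (by exact_mod_cast heq.ge)]
      have h1 := Nat.add_one_mul_choose_eq (N + 1) m
      rw [← heq] at h1
      have h2 : k * (N + 1).choose m = (N + 1 + 1).choose (m + 1) := by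
        rw [← heq]
        apply Nat.eq_of_mul_eq_mul_right (Nat.succ_pos m)
        rw [Nat.succ_eq_add_one, ← h1]
        ring
      rw [← h2]
      push_cast
      ring
    · have hle : k * (m + 1) ≤ N + 1 := by omega
      rw [ncard_succ_succ _ _ _ (by exact_mod_cast hle)]
      push_cast
      rw [ih m hle]
      cases m with
      | zero =>
        rw [ncard_zero]
        simp
        ring
      | succ m =>
        rw [ih m (by nlinarith)]
        rw [Nat.choose_succ_succ (N + 1) (m + 1), Nat.choose_succ_succ N m]
        push_cast
        ring

end boundedThresholdSeq

/-- The number of proper (k,l)-threshold sequences of length n equals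
the Raney number R_{n-1}^{(k,k+l)} = ((k+l)/((k-1)(n-1)+k+l))·binom(kn+l-1, n-1). -/
theorem raney_counts_proper_threshold_sequences (n k l : ℕ) (hn : 1 ≤ n) (hk : 2 ≤ k)
    (hl1 : 1 ≤ l) (hl2 : l ≤ k - 2) :
    (Set.ncard {s : Fin n → ℤ | StrictMono s ∧
        (∀ i : Fin n, (k : ℤ) * (i.1 + 1) ≤ s i ∧ s i ≤ k * n + l) ∧
        s ⟨n - 1, by omega⟩ = k * n + l} : ℚ) =
      ((k + l : ℚ) / (((k : ℚ) - 1) * ((n : ℚ) - 1) + k + l)) *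
        Nat.choose (k * n + l - 1) (n - 1) := by
  obtain ⟨m, rfl⟩ : ∃ m, n = m + 1 := ⟨n - 1, by omega⟩
  have hcard := boundedThresholdSeq.ncard_last_eq k m (k * (m + 1 : ℕ) + l) (by push_cast; omega)
  have hset : {s : Fin (m + 1) → ℤ | StrictMono s ∧
        (∀ i : Fin (m + 1), (k : ℤ) * (i.1 + 1) ≤ s i ∧ s i ≤ k * (m + 1 : ℕ) + l) ∧
        s ⟨m + 1 - 1, by omega⟩ = k * (m + 1 : ℕ) + l} =
      {s ∈ boundedThresholdSeq k (m + 1) (k * (m + 1 : ℕ) + l + 1) |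
        s (Fin.last m) = k * (m + 1 : ℕ) + l} := by
    ext s
    simp only [boundedThresholdSeq, Set.mem_ofPred_eq, Int.lt_add_one_iff, and_assoc]
    rfl
  rw [hset, hcard]
  have hk' : (2 : ℚ) ≤ k := by exact_mod_cast hk
  have hl' : (1 : ℚ) ≤ l := by exact_mod_cast hl1
  have hden : ((k : ℚ) - 1) * (((m + 1 : ℕ) : ℚ) - 1) + k + l ≠ 0 := by
    have : 0 ≤ ((k : ℚ) - 1) * (((m + 1 : ℕ) : ℚ) - 1) :=
      mul_nonneg (by linarith) (by push_cast; simp)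
    linarith
  rw [div_mul_eq_mul_div, eq_div_iff hden]
  cases m with
  | zero =>
    rw [boundedThresholdSeq.ncard_zero]
    simp
  | succ m =>
    obtain ⟨N, hN⟩ : ∃ N, k * (m + 1 + 1) + l = N + 1 :=
      ⟨k * (m + 1 + 1) + l - 1, by omega⟩
    have hmN : m ≤ N := by nlinarith
    have hcount := boundedThresholdSeq.ncard_succ k (by omega) N m (by nlinarith)
    have hNz : (k : ℤ) * ((m + 1 + 1 : ℕ) : ℤ) + l = (N : ℤ) + 1 := by exact_mod_cast hN
    have hNq : (k : ℚ) * ((m : ℚ) + 1 + 1) + l = (N : ℚ) + 1 := by exact_mod_cast hN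
    rw [hNz, hN]
    have hcountq : ((boundedThresholdSeq k (m + 1) ((N : ℤ) + 1)).ncard : ℚ) =
        (N + 1).choose (m + 1) - k * N.choose m := by exact_mod_cast hcount
    have hchoose : (N.choose (m + 1) : ℚ) * (m + 1) = N.choose m * ((N : ℚ) - m) := by
      rw [← Nat.cast_sub hmN]
      exact_mod_cast Nat.choose_succ_right_eq N m
    rw [hcountq, Nat.choose_succ_succ N m]
    simp only [Nat.add_sub_cancel]
    push_cast
    have hNeq : (N : ℚ) = k * (m + 1 + 1) + l - 1 := by linarith
    rw [hNeq] at hchoose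
    linear_combination (k - 1 : ℚ) * hchoose
end

section
/- For every integer n ≥ 1, the number of (3,0)-threshold sequences of length n equals T_n = (1/(2n+1))·binom(3n, n) (the n-th Fuss–Catalan number of order 3, which counts ternary trees with n internal nodes). -/
/-- Strictly increasing integer sequences `s_1 < ⋯ < s_n` with `3 i ≤ s_i ≤ M`. -/
def boundedThresholdSequences (n M : ℕ) : Set (Fin n → ℤ) :=
  {s | StrictMono s ∧ ∀ i : Fin n, 3 * ((i : ℤ) + 1) ≤ s i ∧ s i ≤ M}

lemma finite_boundedThresholdSequences (n M : ℕ) : (boundedThresholdSequences n M).Finite := by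
  refine (Set.Finite.pi' (fun _ : Fin n => Set.finite_Icc (0 : ℤ) M)).subset ?_
  rintro s ⟨-, h⟩ i
  have := h i
  constructor <;> omega

lemma boundedThresholdSequences_zero (M : ℕ) : boundedThresholdSequences 0 M = Set.univ := by
  ext s
  simp [boundedThresholdSequences, Subsingleton.strictMono]

lemma boundedThresholdSequences_eq_empty {n M : ℕ} (h : M < 3 * (n + 1)) :
    boundedThresholdSequences (n + 1) M = ∅ := by
  ext s
  simp only [boundedThresholdSequences, Set.mem_ofPred_eq, Set.mem_empty_iff_false, iff_false]
  rintro ⟨-, hs⟩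
  have := hs (Fin.last n)
  simp only [Fin.val_last] at this
  omega

/-- Split according to whether the last term attains the upper bound. -/
lemma boundedThresholdSequences_succ {n M : ℕ} (h : 3 * (n + 1) ≤ M + 1) :
    boundedThresholdSequences (n + 1) (M + 1) = boundedThresholdSequences (n + 1) M ∪
      (fun s => Fin.snoc (α := fun _ => ℤ) s ((M : ℤ) + 1)) '' boundedThresholdSequences n M := by
  ext s
  constructor
  · rintro ⟨hs, hb⟩
    by_cases hl : s (Fin.last n) ≤ M
    · refine Or.inl ⟨hs, fun i => ⟨(hb i).1, ?_⟩⟩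
      exact (hs.monotone (Fin.le_last i)).trans hl
    · have hl' : s (Fin.last n) = M + 1 := by
        have := (hb (Fin.last n)).2
        push_cast at this
        omega
      refine Or.inr ⟨Fin.init s, ⟨?_, fun i => ?_⟩, ?_⟩
      · intro i j hij
        exact hs (Fin.castSucc_lt_castSucc_iff.2 hij)
      · have h1 := (hb i.castSucc).1
        have h2 := hs (Fin.castSucc_lt_last i)
        simp only [Fin.init, Fin.val_castSucc] at h1 ⊢
        omega
      · simp only [← hl', Fin.snoc_init_self]
  · rintro (⟨hs, hb⟩ | ⟨t, ⟨ht, hb⟩, rfl⟩)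
    · refine ⟨hs, fun i => ⟨(hb i).1, ?_⟩⟩
      have := (hb i).2
      push_cast
      omega
    · refine ⟨?_, fun i => ?_⟩
      · intro i j hij
        induction j using Fin.lastCases with
        | last =>
          induction i using Fin.lastCases with
          | last => exact absurd hij (lt_irrefl _)
          | cast i =>
            have := (hb i).2
            simp only [Fin.snoc_castSucc, Fin.snoc_last]
            omega
        | cast j =>
          induction i using Fin.lastCases with
          | last => exact absurd hij (not_lt.2 (Fin.le_last _))
          | cast i =>
            simp only [Fin.snoc_castSucc]
            exact ht (Fin.castSucc_lt_castSucc_iff.1 hij)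
      · induction i using Fin.lastCases with
        | last =>
          simp only [Fin.snoc_last, Fin.val_last]
          omega
        | cast i =>
          have := hb i
          simp only [Fin.snoc_castSucc, Fin.val_castSucc]
          omega

lemma ncard_boundedThresholdSequences_succ {n M : ℕ} (h : 3 * (n + 1) ≤ M + 1) :
    (boundedThresholdSequences (n + 1) (M + 1)).ncard =
      (boundedThresholdSequences (n + 1) M).ncard + (boundedThresholdSequences n M).ncard := by
  rw [boundedThresholdSequences_succ h, Set.ncard_union_eq ?_
    (finite_boundedThresholdSequences _ _) ((finite_boundedThresholdSequences _ _).image _),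
    Set.ncard_image_of_injective]
  · intro s t hst
    exact (Fin.snoc_injective2 hst).1
  · rw [Set.disjoint_left]
    rintro _ ⟨-, hb⟩ ⟨t, -, rfl⟩
    have := (hb (Fin.last n)).2
    simp only [Fin.snoc_last] at this
    omega

/-- The ballot-type formula for the number of bounded threshold sequences. -/
lemma ncard_boundedThresholdSequences_add (M : ℕ) : ∀ n : ℕ, 3 * (n + 1) ≤ M + 1 →
    (boundedThresholdSequences (n + 1) M).ncard + 3 * M.choose n = (M + 1).choose (n + 1) := by
  induction M with
  | zero => intro n h; omega
  | succ M ih =>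
    intro n h
    rcases h.eq_or_lt with h | h
    · rw [boundedThresholdSequences_eq_empty (by omega), Set.ncard_empty, zero_add]
      have key := Nat.add_one_mul_choose_eq (M + 1) n
      rw [← h] at key ⊢
      refine Nat.eq_of_mul_eq_mul_right (Nat.succ_pos n) ?_
      rw [← Nat.succ_eq_add_one] at key ⊢
      linarith
    · have h' : 3 * (n + 1) ≤ M + 1 := by omega
      rw [ncard_boundedThresholdSequences_succ h', Nat.choose_succ_succ (M + 1) n]
      have h1 := ih n h'
      cases n with
      | zero =>
        simp only [boundedThresholdSequences_zero, Set.ncard_univ, Nat.card_unique,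
          Nat.choose_zero_right, Nat.succ_eq_add_one] at h1 ⊢
        omega
      | succ k =>
        have h2 := ih k (by omega)
        have h3 := Nat.choose_succ_succ M k
        simp only [Nat.succ_eq_add_one] at h1 h2 h3 ⊢
        omega

/-- The number of (3,0)-threshold sequences of length n equals
T_n = (1/(2n+1))·binom(3n, n). -/
theorem count_simple_three_threshold_sequences (n : ℕ) (hn : 1 ≤ n) :
    (Set.ncard {s : Fin n → ℤ | StrictMono s ∧
        ∀ i : Fin n, 3 * ((i : ℤ) + 1) ≤ s i ∧ s i ≤ 3 * n} : ℚ) =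
      (1 / (2 * (n : ℚ) + 1)) * Nat.choose (3 * n) n := by
  obtain ⟨k, rfl⟩ : ∃ k, n = k + 1 := ⟨n - 1, by omega⟩
  have hset : {s : Fin (k + 1) → ℤ | StrictMono s ∧ ∀ i : Fin (k + 1),
      3 * ((i : ℤ) + 1) ≤ s i ∧ s i ≤ 3 * ((k + 1 : ℕ) : ℤ)} =
      boundedThresholdSequences (k + 1) (3 * (k + 1)) := by
    simp [boundedThresholdSequences]
  rw [hset]
  have h1 := ncard_boundedThresholdSequences_add (3 * (k + 1)) k (by omega)
  have h2 := Nat.choose_succ_succ (3 * (k + 1)) k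
  have h3 := Nat.choose_succ_right_eq (3 * (k + 1)) k
  rw [show 3 * (k + 1) - k = 2 * k + 3 by omega] at h3
  simp only [Nat.succ_eq_add_one] at h2
  rw [h2] at h1
  rw [one_div, eq_inv_mul_iff_mul_eq₀ (by positivity)]
  qify at h1 h3
  push_cast
  linear_combination (2 * (k : ℚ) + 3) * h1 + 2 * h3
end

section
/- For every integer n ≥ 1, the number of (3,1)-threshold sequences of length n equals U_n = (1/(n+1))·binom(3n+1, n). -/
/-- Strictly increasing integer sequences `s₁ < ⋯ < sₙ` with `3i ≤ sᵢ ≤ m`. -/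
def thresholdSequences (n m : ℕ) : Set (Fin n → ℤ) :=
  {s | StrictMono s ∧ ∀ i : Fin n, 3 * ((i : ℤ) + 1) ≤ s i ∧ s i ≤ m}

lemma thresholdSequences_finite (n m : ℕ) : (thresholdSequences n m).Finite := by
  refine (Set.finite_Icc (0 : Fin n → ℤ) fun _ => (m : ℤ)).subset fun s hs => ?_
  refine ⟨fun i => ?_, fun i => (hs.2 i).2⟩
  have := (hs.2 i).1
  simp only [Pi.zero_apply]
  omega

lemma ncard_thresholdSequences_zero (m : ℕ) : (thresholdSequences 0 m).ncard = 1 := by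
  rw [Set.ncard_eq_one]
  refine ⟨Fin.elim0, Set.eq_singleton_iff_unique_mem.2 ⟨⟨?_, fun i => i.elim0⟩, ?_⟩⟩
  · exact fun i => i.elim0
  · exact fun s _ => Subsingleton.elim _ _

lemma thresholdSequences_eq_empty {n m : ℕ} (h : m < 3 * (n + 1)) :
    thresholdSequences (n + 1) m = ∅ := by
  refine Set.eq_empty_iff_forall_notMem.2 fun s hs => ?_
  have := hs.2 (Fin.last n)
  simp only [Fin.val_last] at this
  omega

/-- Split the sequences according to whether the last term attains the upper bound. -/
lemma thresholdSequences_succ_succ {n m : ℕ} (h : 3 * (n + 1) ≤ m + 1) :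
    thresholdSequences (n + 1) (m + 1) = thresholdSequences (n + 1) m ∪
      (fun s : Fin n → ℤ => (Fin.snoc s ((m : ℤ) + 1) : Fin (n + 1) → ℤ)) ''
        thresholdSequences n m := by
  ext s
  constructor
  · rintro ⟨hs, hb⟩
    by_cases hl : s (Fin.last n) ≤ m
    · exact Or.inl ⟨hs, fun i => ⟨(hb i).1, (hs.monotone (Fin.le_last i)).trans hl⟩⟩
    · have hlast : s (Fin.last n) = m + 1 := by
        have := (hb (Fin.last n)).2
        push_cast at this
        omega
      refine Or.inr ⟨Fin.init s, ⟨fun i j hij => hs (Fin.castSucc_lt_castSucc_iff.2 hij),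
        fun i => ⟨(hb i.castSucc).1, ?_⟩⟩, ?_⟩
      · have := hs (Fin.castSucc_lt_last i)
        simp only [Fin.init]
        omega
      · simp only [← hlast, Fin.snoc_init_self]
  · rintro (⟨hs, hb⟩ | ⟨t, ⟨ht, hb⟩, rfl⟩)
    · exact ⟨hs, fun i => ⟨(hb i).1, by have := (hb i).2; push_cast; omega⟩⟩
    · refine ⟨fun i j hij => ?_, fun i => ?_⟩
      · induction j using Fin.lastCases with
        | last =>
          induction i using Fin.lastCases with
          | last => exact absurd hij (lt_irrefl _)
          | cast i =>
            have := (hb i).2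
            simp only [Fin.snoc_castSucc, Fin.snoc_last]
            omega
        | cast j =>
          induction i using Fin.lastCases with
          | last => exact absurd hij (Fin.le_last _).not_gt
          | cast i =>
            simp only [Fin.snoc_castSucc]
            exact ht (Fin.castSucc_lt_castSucc_iff.1 hij)
      · induction i using Fin.lastCases with
        | last =>
          simp only [Fin.snoc_last, Fin.val_last]
          push_cast
          omega
        | cast i =>
          have := hb i
          simp only [Fin.snoc_castSucc, Fin.val_castSucc]
          push_cast
          omega

lemma ncard_thresholdSequences_succ_succ {n m : ℕ} (h : 3 * (n + 1) ≤ m + 1) :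
    (thresholdSequences (n + 1) (m + 1)).ncard =
      (thresholdSequences (n + 1) m).ncard + (thresholdSequences n m).ncard := by
  rw [thresholdSequences_succ_succ h, Set.ncard_union_eq _ (thresholdSequences_finite _ _)
    ((thresholdSequences_finite _ _).image _), Set.ncard_image_of_injective]
  · intro s t hst
    simpa using congrArg Fin.init hst
  · rw [Set.disjoint_left]
    rintro _ hs ⟨t, -, rfl⟩
    have := (hs.2 (Fin.last n)).2
    simp only [Fin.snoc_last] at this
    omega

/-- The ballot-type formula `C(m, n + 1) - 2 C(m, n)` for the number of sequences. -/
lemma ncard_thresholdSequences_succ (n m : ℕ) (h : 3 * (n + 1) ≤ m + 1) :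
    (thresholdSequences (n + 1) m).ncard + 2 * m.choose n = m.choose (n + 1) := by
  induction m generalizing n with
  | zero => omega
  | succ m ih =>
    rcases h.eq_or_lt with h | h
    · rw [thresholdSequences_eq_empty (by omega), Set.ncard_empty, zero_add]
      have key := Nat.choose_succ_right_eq (m + 1) n
      rw [show m + 1 - n = 2 * (n + 1) by omega] at key
      exact Nat.eq_of_mul_eq_mul_right (Nat.add_pos_right n one_pos) (by rw [key]; ring)
    · rw [ncard_thresholdSequences_succ_succ (by omega)]
      have h1 := ih n (by omega)
      cases n with
      | zero =>
        rw [ncard_thresholdSequences_zero]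
        simp only [Nat.choose_zero_right, zero_add, Nat.choose_one_right] at h1 ⊢
        omega
      | succ k =>
        have h2 := ih k (by omega)
        rw [Nat.choose_succ_succ' m k, Nat.choose_succ_succ' m (k + 1)]
        omega

/-- The number of (3,1)-threshold sequences of length n equals
U_n = (1/(n+1))·binom(3n+1, n). -/
theorem count_double_three_threshold_sequences (n : ℕ) (hn : 1 ≤ n) :
    (Set.ncard {s : Fin n → ℤ | StrictMono s ∧
        ∀ i : Fin n, 3 * ((i : ℤ) + 1) ≤ s i ∧ s i ≤ 3 * n + 1} : ℚ) =
      (1 / ((n : ℚ) + 1)) * Nat.choose (3 * n + 1) n := by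
  obtain ⟨k, rfl⟩ := Nat.exists_eq_add_of_le' hn
  have hset : {s : Fin (k + 1) → ℤ | StrictMono s ∧ ∀ i : Fin (k + 1),
      3 * ((i : ℤ) + 1) ≤ s i ∧ s i ≤ 3 * (k + 1 : ℕ) + 1} =
      thresholdSequences (k + 1) (3 * (k + 1) + 1) := by
    simp [thresholdSequences]
  rw [hset]
  have hcount := ncard_thresholdSequences_succ k (3 * (k + 1) + 1) (by omega)
  have hchoose := Nat.choose_succ_right_eq (3 * (k + 1) + 1) k
  rw [show 3 * (k + 1) + 1 - k = 2 * (k + 2) by omega] at hchoose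
  have hcountQ := congrArg (Nat.cast : ℕ → ℚ) hcount
  have hchooseQ := congrArg (Nat.cast : ℕ → ℚ) hchoose
  push_cast at hcountQ hchooseQ ⊢
  field_simp
  linear_combination (k + 2 : ℚ) * hcountQ + hchooseQ
end

section
/- Let a_n denote the number of (3,0)-threshold sequences of length n and b_n the number of (3,1)-threshold sequences of length n, with the conventions a_0 = b_0 = 1. Then for every integer n ≥ 2, a_n = 3·a_{n−1} + Σ_{h=1}^{n−2} (a_h + b_h)·a_{n−h−1}. -/
/-- `a n` is the number of (3,0)-threshold sequences of length `n`, with `a 0 = 1`. -/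
noncomputable def a (n : ℕ) : ℕ :=
  if n = 0 then 1 else
    Set.ncard {s : Fin n → ℤ | StrictMono s ∧
      ∀ i : Fin n, 3 * ((i : ℤ) + 1) ≤ s i ∧ s i ≤ 3 * n}

/-- `b n` is the number of (3,1)-threshold sequences of length `n`, with `b 0 = 1`. -/
noncomputable def b (n : ℕ) : ℕ :=
  if n = 0 then 1 else
    Set.ncard {s : Fin n → ℤ | StrictMono s ∧
      ∀ i : Fin n, 3 * ((i : ℤ) + 1) ≤ s i ∧ s i ≤ 3 * n + 1}

/-- Strictly increasing integer sequences of length `n` with `3 * i ≤ s_i ≤ m` for `1 ≤ i ≤ n`. -/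
def thresholdSet (n : ℕ) (m : ℤ) : Set (Fin n → ℤ) :=
  {s | StrictMono s ∧ ∀ i : Fin n, 3 * ((i : ℤ) + 1) ≤ s i ∧ s i ≤ m}

lemma thresholdSet_finite (n : ℕ) (m : ℤ) : (thresholdSet n m).Finite := by
  refine (Set.finite_Icc (fun _ => 0 : Fin n → ℤ) (fun _ => m)).subset fun s hs => ?_
  refine ⟨fun i => ?_, fun i => (hs.2 i).2⟩
  have h := (hs.2 i).1
  show 0 ≤ s i
  omega

lemma ncard_thresholdSet_zero (m : ℤ) : (thresholdSet 0 m).ncard = 1 := by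
  rw [Set.ncard_eq_one]
  refine ⟨Fin.elim0, Set.eq_singleton_iff_unique_mem.2 ⟨⟨fun i => i.elim0, fun i => i.elim0⟩, ?_⟩⟩
  exact fun s _ => Subsingleton.elim _ _

lemma thresholdSet_succ_eq_empty {n : ℕ} {m : ℤ} (h : m < 3 * (n + 1)) :
    thresholdSet (n + 1) m = ∅ := by
  refine Set.eq_empty_of_forall_notMem fun s hs => ?_
  have h' := hs.2 (Fin.last n)
  simp only [Fin.val_last] at h'
  omega

lemma snoc_mem_thresholdSet_iff {n : ℕ} {m x : ℤ} {s : Fin n → ℤ} :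
    Fin.snoc (α := fun _ => ℤ) s x ∈ thresholdSet (n + 1) m ↔
      s ∈ thresholdSet n (x - 1) ∧ 3 * ((n : ℤ) + 1) ≤ x ∧ x ≤ m := by
  constructor
  · rintro ⟨hmono, hb⟩
    refine ⟨⟨fun i j hij => ?_, fun i => ⟨?_, ?_⟩⟩, ?_⟩
    · simpa using hmono (Fin.castSucc_lt_castSucc_iff.2 hij)
    · simpa using (hb i.castSucc).1
    · have := hmono (Fin.castSucc_lt_last i)
      simp only [Fin.snoc_castSucc, Fin.snoc_last] at this
      omega
    · simpa using hb (Fin.last n)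
  · rintro ⟨⟨hmono, hb⟩, hx, hm⟩
    refine ⟨fun i j hij => ?_, fun i => ?_⟩
    · induction j using Fin.lastCases with
      | last =>
        induction i using Fin.lastCases with
        | last => exact absurd hij (lt_irrefl _)
        | cast i =>
          have := (hb i).2
          simp only [Fin.snoc_castSucc, Fin.snoc_last]
          omega
      | cast j =>
        induction i using Fin.lastCases with
        | last => exact absurd hij (Fin.castSucc_lt_last j).asymm
        | cast i => simpa using hmono (Fin.castSucc_lt_castSucc_iff.1 hij)
    · induction i using Fin.lastCases with
      | last => simpa using ⟨hx, hm⟩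
      | cast i =>
        have := hb i
        simp only [Fin.snoc_castSucc, Fin.val_castSucc]
        omega

/-- Splitting according to whether the last entry attains the upper bound. -/
lemma thresholdSet_succ_eq_union {n : ℕ} {m : ℤ} (h : 3 * ((n : ℤ) + 1) ≤ m + 1) :
    thresholdSet (n + 1) (m + 1) = thresholdSet (n + 1) m ∪
      (fun s : Fin n → ℤ => Fin.snoc (α := fun _ => ℤ) s (m + 1)) '' thresholdSet n m := by
  ext s
  induction s using Fin.snocCases with
  | snoc s x =>
    simp only [Set.mem_union, Set.mem_image, snoc_mem_thresholdSet_iff, Fin.snoc_inj]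
    constructor
    · rintro ⟨hs, hx, hm⟩
      rcases hm.eq_or_lt with rfl | hlt
      · exact Or.inr ⟨s, by simpa using hs, rfl, rfl⟩
      · exact Or.inl ⟨hs, hx, by omega⟩
    · rintro (⟨hs, hx, hm⟩ | ⟨_, hs, rfl, rfl⟩)
      · exact ⟨hs, hx, by omega⟩
      · exact ⟨by simpa using hs, h, le_rfl⟩

lemma ncard_thresholdSet_succ {n : ℕ} {m : ℤ} (h : 3 * ((n : ℤ) + 1) ≤ m + 1) :
    (thresholdSet (n + 1) (m + 1)).ncard =
      (thresholdSet (n + 1) m).ncard + (thresholdSet n m).ncard := by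
  rw [thresholdSet_succ_eq_union h, Set.ncard_union_eq _ (thresholdSet_finite _ _)
    ((thresholdSet_finite _ _).image _), Set.ncard_image_of_injective]
  · exact fun s t hst => (Fin.snoc_inj.1 hst).1
  · rw [Set.disjoint_left]
    rintro _ hs ⟨t, _, rfl⟩
    have := (snoc_mem_thresholdSet_iff.1 hs).2.2
    omega

open PowerSeries in
/-- The generating function, over the length `n`, of threshold sequences bounded by
`3 * n + k - 1`. -/
noncomputable def thresholdSeries (k : ℕ) : ℕ⟦X⟧ :=
  PowerSeries.mk fun n => (thresholdSet n (3 * n + k - 1)).ncard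

lemma thresholdSeries_zero : thresholdSeries 0 = 1 := by
  ext n
  rw [thresholdSeries, PowerSeries.coeff_mk, PowerSeries.coeff_one]
  cases n with
  | zero => exact ncard_thresholdSet_zero _
  | succ n =>
    rw [thresholdSet_succ_eq_empty (by push_cast; omega)]
    simp

lemma thresholdSeries_succ (k : ℕ) :
    thresholdSeries (k + 1) = thresholdSeries k + PowerSeries.X * thresholdSeries (k + 3) := by
  ext n
  cases n with
  | zero => simp [thresholdSeries, ncard_thresholdSet_zero]
  | succ n =>
    rw [map_add, PowerSeries.coeff_succ_X_mul]
    simp only [thresholdSeries, PowerSeries.coeff_mk]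
    have h := ncard_thresholdSet_succ (n := n) (m := 3 * n + k + 2) (by omega)
    convert h using 3 <;> push_cast <;> ring_nf

lemma thresholdSeries_mul_one (k : ℕ) :
    thresholdSeries k * thresholdSeries 1 = thresholdSeries (k + 1) := by
  ext n
  induction n generalizing k with
  | zero => simp [thresholdSeries, ncard_thresholdSet_zero]
  | succ n ihn =>
    induction k with
    | zero => rw [thresholdSeries_zero, one_mul]
    | succ k ihk =>
      rw [thresholdSeries_succ k, add_mul, mul_assoc, map_add, PowerSeries.coeff_succ_X_mul,
        ihk, ihn, thresholdSeries_succ (k + 1), map_add, PowerSeries.coeff_succ_X_mul]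

lemma coeff_thresholdSeries_one (n : ℕ) : PowerSeries.coeff n (thresholdSeries 1) = a n := by
  rw [thresholdSeries, PowerSeries.coeff_mk, a]
  split_ifs with h
  · subst h
    exact ncard_thresholdSet_zero _
  · simp [thresholdSet]

lemma coeff_thresholdSeries_two (n : ℕ) : PowerSeries.coeff n (thresholdSeries 2) = b n := by
  rw [thresholdSeries, PowerSeries.coeff_mk, b]
  split_ifs with h
  · subst h
    exact ncard_thresholdSet_zero _
  · have : (3 * n + (2 : ℕ) - 1 : ℤ) = 3 * n + 1 := by push_cast; ring
    rw [this, thresholdSet]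

lemma sum_antidiagonal_eq_ends_add_Icc (f g : ℕ → ℕ) (m : ℕ) :
    ∑ p ∈ Finset.HasAntidiagonal.antidiagonal (m + 1), f p.1 * g p.2 =
      f 0 * g (m + 1) + f (m + 1) * g 0 + ∑ h ∈ Finset.Icc 1 m, f h * g (m + 1 - h) := by
  rw [Finset.Nat.sum_antidiagonal_eq_sum_range_succ (fun i j => f i * g j),
    Finset.sum_range_succ, Finset.range_eq_Ico, Finset.sum_eq_sum_Ico_succ_bot (by omega)]
  simp only [Nat.sub_zero, Nat.sub_self, zero_add, Finset.Ico_add_one_right_eq_Icc]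
  ring

/-- a_n = 3·a_{n-1} + Σ_{h=1}^{n-2} (a_h + b_h)·a_{n-h-1} for n ≥ 2. -/
theorem a_recurrence (n : ℕ) (hn : 2 ≤ n) :
    a n = 3 * a (n - 1) + ∑ h ∈ Finset.Icc 1 (n - 2), (a h + b h) * a (n - h - 1) := by
  obtain ⟨m, rfl⟩ := Nat.exists_eq_add_of_le' hn
  have ha0 : a 0 = 1 := if_pos rfl
  have hb0 : b 0 = 1 := if_pos rfl
  have hb : b (m + 1) = ∑ p ∈ Finset.HasAntidiagonal.antidiagonal (m + 1), a p.1 * a p.2 := by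
    rw [← coeff_thresholdSeries_two, ← thresholdSeries_mul_one 1, PowerSeries.coeff_mul]
    simp only [coeff_thresholdSeries_one]
  have ha : a (m + 2) = ∑ p ∈ Finset.HasAntidiagonal.antidiagonal (m + 1), b p.1 * a p.2 := by
    rw [← coeff_thresholdSeries_one, thresholdSeries_succ 0, zero_add, map_add,
      PowerSeries.coeff_succ_X_mul, ← thresholdSeries_mul_one 2, PowerSeries.coeff_mul,
      thresholdSeries_zero, PowerSeries.coeff_one, if_neg (by omega), zero_add]
    simp only [coeff_thresholdSeries_one, coeff_thresholdSeries_two]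
  rw [sum_antidiagonal_eq_ends_add_Icc] at ha hb
  have hsub : ∀ h, m + 2 - h - 1 = m + 1 - h := by omega
  simp only [Nat.add_sub_cancel, hsub, add_mul, Finset.sum_add_distrib,
    show m + 2 - 1 = m + 1 by omega]
  rw [ha0] at hb ha
  rw [hb0] at ha
  omega
end

section
/- Let a_n denote the number of (3,0)-threshold sequences of length n and b_n the number of (3,1)-threshold sequences of length n, with the conventions a_0 = b_0 = 1. Then for every integer n ≥ 1, b_n = Σ_{h=0}^{n} a_h·a_{n−h}. -/
/-- The `(3, l)`-threshold sequences of length `n`, indexed from `0`. -/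
def thresholdSeqs (l n : ℕ) : Set (Fin n → ℤ) :=
  {s | StrictMono s ∧ ∀ i : Fin n, 3 * ((i : ℤ) + 1) ≤ s i ∧ s i ≤ 3 * n + l}

theorem finite_thresholdSeqs (l n : ℕ) : (thresholdSeqs l n).Finite := by
  refine (Set.finite_Icc (fun _ => (0 : ℤ)) (fun _ => (3 * n + l : ℤ))).subset fun s hs => ⟨?_, ?_⟩
  · intro i
    have := (hs.2 i).1
    dsimp only
    omega
  · exact fun i => (hs.2 i).2

theorem ncard_thresholdSeqs_zero (l : ℕ) : (thresholdSeqs l 0).ncard = 1 :=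
  Set.ncard_eq_one.2 ⟨Fin.elim0, Set.eq_singleton_iff_unique_mem.2
    ⟨⟨fun i => i.elim0, fun i => i.elim0⟩, fun _ _ => Subsingleton.elim _ _⟩⟩

theorem a_eq_card (n : ℕ) : a n = Nat.card (thresholdSeqs 0 n) := by
  rw [Nat.card_coe_set_eq]
  rcases eq_or_ne n 0 with rfl | hn
  · simp [a, ncard_thresholdSeqs_zero]
  · simp [a, hn, thresholdSeqs]

theorem b_eq_card (n : ℕ) : b n = Nat.card (thresholdSeqs 1 n) := by
  rw [Nat.card_coe_set_eq]
  rcases eq_or_ne n 0 with rfl | hn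
  · simp [b, ncard_thresholdSeqs_zero]
  · simp [b, hn, thresholdSeqs]

/-- The sequence `u` followed by the translate of `v` by `3 * h + 1`. -/
def glue {n h : ℕ} (u : Fin h → ℤ) (v : Fin (n - h) → ℤ) (i : Fin n) : ℤ :=
  if hi : (i : ℕ) < h then u ⟨i, hi⟩ else v ⟨i - h, by omega⟩ + (3 * h + 1)

theorem glue_of_lt {n h : ℕ} (u : Fin h → ℤ) (v : Fin (n - h) → ℤ) {i : Fin n}
    (hi : (i : ℕ) < h) : glue u v i = u ⟨i, hi⟩ := dif_pos hi

theorem glue_of_le {n h : ℕ} (u : Fin h → ℤ) (v : Fin (n - h) → ℤ) {i : Fin n}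
    (hi : h ≤ (i : ℕ)) : glue u v i = v ⟨i - h, by omega⟩ + (3 * h + 1) := dif_neg hi.not_gt

theorem glue_le_of_lt {n h : ℕ} {u : Fin h → ℤ} (hu : u ∈ thresholdSeqs 0 h)
    (v : Fin (n - h) → ℤ) {i : Fin n} (hi : (i : ℕ) < h) : glue u v i ≤ 3 * h := by
  rw [glue_of_lt u v hi]
  simpa using (hu.2 ⟨i, hi⟩).2

theorem lt_glue_of_le {n h : ℕ} (u : Fin h → ℤ) {v : Fin (n - h) → ℤ}
    (hv : v ∈ thresholdSeqs 0 (n - h)) {i : Fin n} (hi : h ≤ (i : ℕ)) :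
    3 * ((i : ℤ) + 1) < glue u v i := by
  rw [glue_of_le u v hi]
  have := (hv.2 ⟨i - h, by omega⟩).1
  push_cast [hi] at this
  omega

theorem glue_mem {n h : ℕ} (hn : h ≤ n) {u : Fin h → ℤ} {v : Fin (n - h) → ℤ}
    (hu : u ∈ thresholdSeqs 0 h) (hv : v ∈ thresholdSeqs 0 (n - h)) :
    glue u v ∈ thresholdSeqs 1 n := by
  refine ⟨fun i j hij => ?_, fun i => ?_⟩
  · have hij' : (i : ℕ) < j := hij
    rcases lt_or_ge (j : ℕ) h with hj | hj
    · rw [glue_of_lt u v hj, glue_of_lt u v (hij'.trans hj)]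
      exact hu.1 hij
    rcases lt_or_ge (i : ℕ) h with hi | hi
    · have h₁ := glue_le_of_lt hu v hi
      have h₂ := lt_glue_of_le u hv hj
      omega
    · rw [glue_of_le u v hi, glue_of_le u v hj]
      refine add_lt_add_left (hv.1 ?_) _
      rw [Fin.mk_lt_mk]
      omega
  · rcases lt_or_ge (i : ℕ) h with hi | hi
    · have h₁ := glue_le_of_lt hu v hi
      have h₂ := (hu.2 ⟨i, hi⟩).1
      rw [← glue_of_lt u v hi] at h₂
      dsimp only at h₂
      omega
    · have h₁ := lt_glue_of_le u hv hi
      refine ⟨h₁.le, ?_⟩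
      have h₂ := (hv.2 ⟨i - h, by omega⟩).2
      rw [glue_of_le u v hi]
      push_cast [hn] at h₂ ⊢
      omega

theorem le_of_glue_eq {n h k : ℕ} (hk : k ≤ n) {u : Fin h → ℤ} {v : Fin (n - h) → ℤ}
    {u' : Fin k → ℤ} {v' : Fin (n - k) → ℤ} (hv : v ∈ thresholdSeqs 0 (n - h))
    (hu' : u' ∈ thresholdSeqs 0 k) (H : glue u v = glue (n := n) u' v') : k ≤ h := by
  by_contra! hlt
  have h₁ := lt_glue_of_le (i := ⟨k - 1, by omega⟩) u hv (show h ≤ k - 1 by omega)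
  have h₂ := glue_le_of_lt (i := ⟨k - 1, by omega⟩) hu' v' (show k - 1 < k by omega)
  rw [H] at h₁
  dsimp only at h₁
  omega

theorem glue_injective {n h : ℕ} {u u' : Fin h → ℤ} {v v' : Fin (n - h) → ℤ} (hn : h ≤ n)
    (H : glue u v = glue u' v') : u = u' ∧ v = v' := by
  refine ⟨funext fun i => ?_, funext fun i => ?_⟩
  · have := congrFun H ⟨i, by omega⟩
    rwa [glue_of_lt u v (i := ⟨i, by omega⟩) i.2, glue_of_lt u' v' (i := ⟨i, by omega⟩) i.2] at this
  · have := congrFun H ⟨i + h, by omega⟩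
    rw [glue_of_le _ _ (Nat.le_add_left _ _), glue_of_le _ _ (Nat.le_add_left _ _)] at this
    simpa using this

/-- A `(3, 1)`-threshold sequence is cut at the last `h` with `s_h = 3 * h`. -/
theorem exists_glue_eq {n : ℕ} {s : Fin n → ℤ} (hs : s ∈ thresholdSeqs 1 n) :
    ∃ h ≤ n, ∃ u ∈ thresholdSeqs 0 h, ∃ v ∈ thresholdSeqs 0 (n - h), glue u v = s := by
  classical
  let P : ℕ → Prop := fun h => ∀ i : Fin n, (i : ℕ) < h → s i ≤ 3 * h
  obtain ⟨h, hn, hP, hmax⟩ : ∃ h ≤ n, P h ∧ ∀ k, h < k → k ≤ n → ¬ P k :=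
    ⟨Nat.findGreatest P n, Nat.findGreatest_le n,
      Nat.findGreatest_spec (Nat.zero_le n) (fun i hi => absurd hi (Nat.not_lt_zero _)),
      fun _ => Nat.findGreatest_is_greatest⟩
  have hgt (i : Fin n) (hi : h ≤ (i : ℕ)) : 3 * ((i : ℤ) + 1) < s i := by
    have hk := hmax (i + 1) (by omega) i.2
    simp only [P, not_forall, not_le] at hk
    obtain ⟨j, hj, hlt⟩ := hk
    have := hs.1.monotone (show j ≤ i from Nat.lt_succ_iff.1 hj)
    push_cast at hlt
    omega
  refine ⟨h, hn, fun i => s ⟨i, by omega⟩, ⟨fun i j hij => hs.1 hij, fun i => ⟨?_, ?_⟩⟩,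
    fun i => s ⟨i + h, by omega⟩ - (3 * h + 1), ⟨fun i j hij => ?_, fun i => ⟨?_, ?_⟩⟩, ?_⟩
  · exact (hs.2 ⟨i, by omega⟩).1
  · simpa using hP ⟨i, by omega⟩ i.2
  · refine sub_lt_sub_right (hs.1 ?_) _
    exact Nat.add_lt_add_right hij h
  · have := hgt ⟨i + h, by omega⟩ (Nat.le_add_left _ _)
    push_cast at this
    dsimp only
    omega
  · have := (hs.2 ⟨i + h, by omega⟩).2
    push_cast [hn] at this ⊢
    omega
  · funext i
    rcases lt_or_ge (i : ℕ) h with hi | hi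
    · rw [glue_of_lt _ _ hi]
    · rw [glue_of_le _ _ hi]
      simp [Nat.sub_add_cancel hi]

/-- b_n = Σ_{h=0}^{n} a_h·a_{n-h} for n ≥ 1. -/
theorem b_eq_sum_a_mul_a (n : ℕ) (hn : 1 ≤ n) :
    b n = ∑ h ∈ Finset.range (n + 1), a h * a (n - h) := by
  have hfin (m : ℕ) : Finite (thresholdSeqs 0 m) := finite_thresholdSeqs 0 m
  let f : (Σ h : Fin (n + 1), thresholdSeqs 0 h × thresholdSeqs 0 (n - h)) → thresholdSeqs 1 n :=
    fun x => ⟨glue x.2.1.1 x.2.2.1, glue_mem (Nat.lt_succ_iff.1 x.1.2) x.2.1.2 x.2.2.2⟩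
  have hf : Function.Bijective f := by
    constructor
    · rintro ⟨h, ⟨u, hu⟩, v, hv⟩ ⟨k, ⟨u', hu'⟩, v', hv'⟩ H
      have H' : glue u v = glue u' v' := congrArg Subtype.val H
      obtain rfl : h = k := Fin.ext <| le_antisymm
        (le_of_glue_eq (Nat.lt_succ_iff.1 h.2) hv' hu H'.symm)
        (le_of_glue_eq (Nat.lt_succ_iff.1 k.2) hv hu' H')
      obtain ⟨rfl, rfl⟩ := glue_injective (Nat.lt_succ_iff.1 h.2) H'
      rfl
    · rintro ⟨s, hs⟩
      obtain ⟨h, hn, u, hu, v, hv, rfl⟩ := exists_glue_eq hs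
      exact ⟨⟨⟨h, Nat.lt_succ_iff.2 hn⟩, ⟨u, hu⟩, ⟨v, hv⟩⟩, rfl⟩
  rw [b_eq_card, ← Nat.card_congr (Equiv.ofBijective f hf), Nat.card_sigma, Finset.sum_range]
  simp only [Nat.card_prod, a_eq_card]
end

section
/- Define T_n = (1/(2n+1))·binom(3n, n) and U_n = (1/(n+1))·binom(3n+1, n) as rational numbers. For every integer n ≥ 1, Σ_{h=0}^{n−1} T_h·T_{n−h} = Σ_{h=0}^{n−1} U_h·U_{n−1−h} = (2/(n+1))·binom(3n, n−1). -/
/-- The Fuss–Catalan number T_n = (1/(2n+1))·binom(3n, n), as a rational number. -/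
noncomputable def T (n : ℕ) : ℚ := (1 / (2 * (n : ℚ) + 1)) * Nat.choose (3 * n) n

/-- The Raney number U_n = R_n^{(3,2)} = (1/(n+1))·binom(3n+1, n), as a rational number. -/
noncomputable def U (n : ℕ) : ℚ := (1 / ((n : ℚ) + 1)) * Nat.choose (3 * n + 1) n

/-- The Raney number `R_n^{(3,x)} = (x/(x+3n))·binom(x+3n, n)`, in a division-free form
that also makes sense for `n = x = 0`. -/
def raney : ℕ → ℕ → ℚ
  | 0, _ => 1
  | n + 1, x => (x + 3 * n + 2).choose (n + 1) - 2 * (x + 3 * n + 2).choose n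

theorem raney_mul_add (n x : ℕ) :
    raney n x * (x + 3 * n) = x * (x + 3 * n).choose n := by
  cases n with
  | zero => simp [raney]
  | succ n =>
    have h : ((x + 3 * n + 2).choose (n + 1) : ℚ) * (n + 1) =
        (x + 3 * n + 2).choose n * (x + 2 * n + 2) := by
      have := Nat.choose_succ_right_eq (x + 3 * n + 2) n
      rw [show x + 3 * n + 2 - n = x + 2 * n + 2 by omega] at this
      exact_mod_cast this
    rw [raney, show x + 3 * (n + 1) = (x + 3 * n + 2) + 1 by ring,
      Nat.choose_succ_succ' (x + 3 * n + 2) n]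
    push_cast
    linear_combination 3 * h

theorem raney_succ_zero (n : ℕ) : raney (n + 1) 0 = 0 := by
  have h := raney_mul_add (n + 1) 0
  rw [Nat.cast_zero, zero_mul] at h
  exact (mul_eq_zero.mp h).resolve_right (by positivity)

theorem raney_succ_succ (n x : ℕ) :
    raney (n + 1) (x + 1) = raney (n + 1) x + raney n (x + 3) := by
  cases n with
  | zero =>
    simp [raney]
  | succ n =>
    simp only [raney]
    rw [show x + 1 + 3 * (n + 1) + 2 = (x + 3 * (n + 1) + 2) + 1 by ring,
      show x + 3 + 3 * n + 2 = x + 3 * (n + 1) + 2 by ring,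
      Nat.choose_succ_succ' (x + 3 * (n + 1) + 2) (n + 1),
      Nat.choose_succ_succ' (x + 3 * (n + 1) + 2) n]
    push_cast
    ring

/-- The Rothe–Hagen convolution identity for Raney numbers of order 3. -/
theorem sum_raney_mul_raney (n x y : ℕ) :
    ∑ k ∈ Finset.range (n + 1), raney k x * raney (n - k) y = raney n (x + y) := by
  induction n generalizing x with
  | zero => simp [raney]
  | succ n ihn =>
    rw [Finset.sum_range_succ']
    simp only [Nat.add_sub_add_right]
    induction x with
    | zero =>
      simp only [raney_succ_zero, zero_mul, Finset.sum_const_zero, zero_add]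
      simp [raney]
    | succ x ihx =>
      simp only [raney_succ_succ, add_mul, Finset.sum_add_distrib]
      rw [ihn, show x + 1 + y = x + y + 1 by ring, raney_succ_succ, ← ihx,
        show x + 3 + y = x + y + 3 by ring]
      simp only [raney]
      ring

theorem T_eq_raney (n : ℕ) : T n = raney n 1 := by
  have h := raney_mul_add n 1
  have hc : ((3 * n).choose n : ℚ) * (3 * n + 1) = (1 + 3 * n).choose n * (2 * n + 1) := by
    have := Nat.choose_mul_succ_eq (3 * n) n
    rw [show 3 * n + 1 - n = 2 * n + 1 by omega, add_comm (3 * n) 1] at this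
    rw [add_comm (3 * (n : ℚ)) 1]
    exact_mod_cast this
  have h₁ : (3 * n + 1 : ℚ) ≠ 0 := by positivity
  rw [T, one_div_mul_eq_div, div_eq_iff (by positivity)]
  apply mul_right_cancel₀ h₁
  push_cast at h
  linear_combination hc - (2 * n + 1) * h

theorem U_eq_raney (n : ℕ) : U n = raney n 2 := by
  have h := raney_mul_add n 2
  have hc : ((3 * n + 1).choose n : ℚ) * (3 * n + 2) =
      (2 + 3 * n).choose n * (2 * n + 2) := by
    have := Nat.choose_mul_succ_eq (3 * n + 1) n
    rw [show 3 * n + 1 + 1 - n = 2 * n + 2 by omega,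
      show 3 * n + 1 + 1 = 2 + 3 * n by ring] at this
    rw [add_comm (3 * (n : ℚ)) 2]
    exact_mod_cast this
  have h₁ : (3 * n + 2 : ℚ) ≠ 0 := by positivity
  rw [U, one_div_mul_eq_div, div_eq_iff (by positivity)]
  apply mul_right_cancel₀ h₁
  push_cast at h
  linear_combination hc - (n + 1) * h

theorem raney_four (n : ℕ) : raney n 4 = 2 / (n + 2) * (3 * n + 3).choose n := by
  have h := raney_mul_add n 4
  have hc : ((3 * n + 3).choose n : ℚ) * (3 * n + 4) =
      (4 + 3 * n).choose n * (2 * n + 4) := by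
    have := Nat.choose_mul_succ_eq (3 * n + 3) n
    rw [show 3 * n + 3 + 1 - n = 2 * n + 4 by omega,
      show 3 * n + 3 + 1 = 4 + 3 * n by ring] at this
    rw [add_comm (3 * (n : ℚ)) 4]
    exact_mod_cast this
  have h₁ : (3 * n + 4 : ℚ) ≠ 0 := by positivity
  rw [div_mul_eq_mul_div, eq_div_iff (by positivity)]
  apply mul_right_cancel₀ h₁
  push_cast at h
  linear_combination (n + 2) * h - 2 * hc

/-- Σ_{h=0}^{n-1} T_h·T_{n-h} = Σ_{h=0}^{n-1} U_h·U_{n-1-h}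
= (2/(n+1))·binom(3n, n−1) for n ≥ 1. -/
theorem sum_T_eq_sum_U (n : ℕ) (hn : 1 ≤ n) :
    (∑ h ∈ Finset.range n, T h * T (n - h) = ∑ h ∈ Finset.range n, U h * U (n - 1 - h)) ∧
    (∑ h ∈ Finset.range n, T h * T (n - h) =
      (2 / ((n : ℚ) + 1)) * Nat.choose (3 * n) (n - 1)) := by
  obtain ⟨m, rfl⟩ : ∃ m, n = m + 1 := ⟨n - 1, by omega⟩
  have hT : ∑ h ∈ Finset.range (m + 1), T h * T (m + 1 - h) = raney m 4 := by
    have h := sum_raney_mul_raney (m + 1) 1 1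
    rw [Finset.sum_range_succ, Nat.sub_self, raney_succ_succ m 1] at h
    simp only [T_eq_raney]
    have h₀ : raney 0 1 = 1 := rfl
    rw [h₀, mul_one, add_comm (raney (m + 1) 1)] at h
    exact add_right_cancel h
  have hU : ∑ h ∈ Finset.range (m + 1), U h * U (m + 1 - 1 - h) = raney m 4 := by
    simp only [U_eq_raney, Nat.add_sub_cancel]
    exact sum_raney_mul_raney m 2 2
  refine ⟨hT.trans hU.symm, ?_⟩
  rw [hT, raney_four, Nat.add_sub_cancel, show 3 * (m + 1) = 3 * m + 3 by ring]
  push_cast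
  ring
end

section
/- For every integer n ≥ 1, the Catalan numbers satisfy C_n = Σ_{r+s+t=n−1, r≥1, s≥1, t≥0} C_r·C_s·2^t + 2^{n−1}, where the sum is over all triples (r,s,t) of integers with r ≥ 1, s ≥ 1, t ≥ 0 and r + s + t = n − 1. -/
/-- The part of Segner's convolution `∑ C_r C_s` over `r + s = k` with both indices positive. -/
def catalanPosConv (k : ℕ) : ℕ :=
  ∑ p ∈ (Finset.HasAntidiagonal.antidiagonal k).filter (fun p => 1 ≤ p.1 ∧ 1 ≤ p.2),
    catalan p.1 * catalan p.2

theorem catalan_add_two (m : ℕ) :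
    catalan (m + 2) = catalanPosConv (m + 1) + 2 * catalan (m + 1) := by
  rw [catalan_succ', catalanPosConv, Finset.sum_filter]
  cases m with
  | zero => simp [Finset.Nat.antidiagonal_succ]
  | succ m =>
    rw [Finset.Nat.sum_antidiagonal_succ, Finset.Nat.sum_antidiagonal_succ',
      Finset.Nat.sum_antidiagonal_succ, Finset.Nat.sum_antidiagonal_succ']
    simp
    ring

theorem catalan_succ_eq_sum_catalanPosConv (m : ℕ) :
    catalan (m + 1) =
      (∑ x ∈ Finset.HasAntidiagonal.antidiagonal m, catalanPosConv x.1 * 2 ^ x.2) + 2 ^ m := by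
  induction m with
  | zero => simp [catalanPosConv, Finset.sum_filter]
  | succ m ih =>
    rw [catalan_add_two, Finset.Nat.sum_antidiagonal_succ', ih]
    simp only [pow_succ, ← mul_assoc, ← Finset.sum_mul]
    ring

/-- C_n = Σ_{r+s+t=n−1, r≥1, s≥1, t≥0} C_r·C_s·2^t + 2^{n−1}, where
C_n is the n-th Catalan number. -/
theorem catalan_recurrence (n : ℕ) (hn : 1 ≤ n) :
    catalan n =
      (∑ p ∈ (Finset.range n ×ˢ Finset.range n ×ˢ Finset.range n).filter
          (fun p => 1 ≤ p.1 ∧ 1 ≤ p.2.1 ∧ p.1 + p.2.1 + p.2.2 = n - 1),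
        catalan p.1 * catalan p.2.1 * 2 ^ p.2.2) + 2 ^ (n - 1) := by
  obtain ⟨m, rfl⟩ := Nat.exists_eq_add_of_le' hn
  rw [catalan_succ_eq_sum_catalanPosConv, Nat.add_sub_cancel]
  simp only [catalanPosConv, Finset.sum_mul]
  rw [Finset.sum_sigma']
  congr 1
  refine Finset.sum_nbij' (fun x => (x.2.1, x.2.2, x.1.2))
    (fun p => ⟨(p.1 + p.2.1, p.2.2), (p.1, p.2.1)⟩) ?_ ?_ ?_ ?_ ?_
  · rintro ⟨⟨k, t⟩, r, s⟩ h
    simp only [Finset.mem_sigma, Finset.HasAntidiagonal.mem_antidiagonal, Finset.mem_filter,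
      Finset.mem_product, Finset.mem_range] at h ⊢
    omega
  · rintro ⟨r, s, t⟩ h
    simp only [Finset.mem_sigma, Finset.HasAntidiagonal.mem_antidiagonal, Finset.mem_filter,
      Finset.mem_product, Finset.mem_range, true_and] at h ⊢
    omega
  · rintro ⟨⟨k, t⟩, r, s⟩ h
    simp only [Finset.mem_sigma, Finset.HasAntidiagonal.mem_antidiagonal, Finset.mem_filter] at h
    obtain ⟨-, rfl, -⟩ := h
    rfl
  · intros
    rfl
  · intros
    rfl
end

section
/- Let k, l, n be integers with k ≥ 2, 0 ≤ l ≤ k−2 and n ≥ 1. The map sending a sequence (s_1, …, s_n) to the height sequence (y_0, y_1, …, y_n) with y_0 = 0 and y_i = s_i − k·i is a bijection from the set of proper (k,l)-threshold sequences of length n onto the set of (k,l)-extended Motzkin paths of length n ending at height l, i.e., onto the set of sequences (y_0, …, y_n) of integers with y_0 = 0, y_i ≥ 0 for all i, y_i − y_{i−1} ≥ −(k−1) for all 1 ≤ i ≤ n, and y_n = l. -/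
/-- the map sending a proper (k,l)-threshold sequence (s_1,…,s_n)
to its height sequence (y_0,…,y_n), with y_0 = 0 and y_i = s_i − k·i, is a
bijection onto the set of (k,l)-extended Motzkin paths of length n ending at
height l. -/
theorem threshold_to_motzkin_bijection (k l n : ℕ) (hk : 2 ≤ k) (hl : l ≤ k - 2)
    (hn : 1 ≤ n) :
    Set.BijOn
      (fun (s : Fin n → ℤ) (i : Fin (n + 1)) =>
        if h : i.1 = 0 then 0 else s ⟨i.1 - 1, by omega⟩ - k * i.1)
      {s : Fin n → ℤ | StrictMono s ∧
        (∀ i : Fin n, (k : ℤ) * (i.1 + 1) ≤ s i ∧ s i ≤ k * n + l) ∧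
        s ⟨n - 1, by omega⟩ = k * n + l}
      {y : Fin (n + 1) → ℤ | y 0 = 0 ∧ (∀ i, 0 ≤ y i) ∧
        (∀ i : Fin n, y i.succ - y i.castSucc ≥ -((k : ℤ) - 1)) ∧
        y (Fin.last n) = l} := by
  obtain ⟨m, rfl⟩ : ∃ m, n = m + 1 := ⟨n - 1, by omega⟩
  have hk' : (2 : ℤ) ≤ k := by exact_mod_cast hk
  refine ⟨?_, ?_, ?_⟩
  · rintro s ⟨hmono, hbound, hlast⟩
    refine ⟨by simp, fun i => ?_, fun i => ?_, ?_⟩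
    · cases i using Fin.cases with
      | zero => simp
      | succ i => simpa using (hbound i).1
    · cases i using Fin.cases with
      | zero =>
        have h := (hbound 0).1
        simp only [Fin.val_zero, Nat.cast_zero, zero_add, mul_one] at h
        simp
        linarith
      | succ j =>
        have h : s j.castSucc < s j.succ := hmono Fin.castSucc_lt_succ
        change s j.castSucc + 1 ≤ s j.succ at h
        change s j.succ - (k : ℤ) * ((j.1 + 1 + 1 : ℕ) : ℤ)
          - (s j.castSucc - (k : ℤ) * ((j.1 + 1 : ℕ) : ℤ)) ≥ -((k : ℤ) - 1)
        push_cast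
        linarith
    · change s ⟨m, _⟩ - (k : ℤ) * ((m + 1 : ℕ) : ℤ) = l
      change s ⟨m, _⟩ = _ at hlast
      rw [hlast]
      ring
  · rintro s - t - hst
    funext i
    simpa using congrFun hst i.succ
  · rintro y ⟨hzero, hnonneg, hstep, hlast⟩
    have hmono : StrictMono fun i : Fin (m + 1) => y i.succ + (k : ℤ) * (i.1 + 1) := by
      refine Fin.strictMono_iff_lt_succ.2 fun i => ?_
      have h := hstep i.succ
      rw [← Fin.succ_castSucc] at h
      simp only [Fin.val_castSucc, Fin.val_succ]
      push_cast
      linarith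
    have htop : y (Fin.last m).succ + (k : ℤ) * ((Fin.last m).1 + 1)
        = k * ((m + 1 : ℕ) : ℤ) + l := by
      rw [Fin.succ_last, hlast, Fin.val_last]
      push_cast
      ring
    refine ⟨fun i => y i.succ + (k : ℤ) * (i.1 + 1), ⟨hmono, fun i => ⟨?_, ?_⟩, htop⟩, ?_⟩
    · exact le_add_of_nonneg_left (hnonneg i.succ)
    · exact (hmono.monotone (Fin.le_last i)).trans_eq htop
    · funext i
      cases i using Fin.cases with
      | zero => simp [hzero]
      | succ i => simp
end

section
/- Let k, l, n be integers with k ≥ 2, 1 ≤ l ≤ k−2 and n ≥ 1. The number of (k,l)-extended Motzkin paths of length n ending at height l, i.e., of sequences (y_0, …, y_n) of integers with y_0 = 0, y_i ≥ 0 for all i, y_i − y_{i−1} ≥ −(k−1) for all 1 ≤ i ≤ n, and y_n = l, equals the Raney number R_{n−1}^{(k,k+l)} = ((k+l)/((k−1)(n−1)+k+l))·binom(kn+l−1, n−1). -/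
/-- The numbers determined by `raneyCount k 0 r = 1` and
`raneyCount k (m + 1) r = ∑ j < r, raneyCount k m (k + j)`; these are the Raney numbers. -/
def raneyCount (k : ℕ) : ℕ → ℕ → ℕ
  | 0, _ => 1
  | m + 1, r => ∑ j ∈ Finset.range r, raneyCount k m (k + j)

theorem raneyCount_succ_succ (k m r : ℕ) :
    raneyCount k (m + 1) (r + 1) = raneyCount k (m + 1) r + raneyCount k m (k + r) := by
  simp [raneyCount, Finset.sum_range_succ]

theorem succ_mul_raneyCount (p m r : ℕ) :
    (m + 1) * raneyCount (p + 1) (m + 1) r = r * ((p + 1) * m + p + r).choose m := by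
  induction m generalizing r with
  | zero => simp [raneyCount]
  | succ m ihm =>
    induction r with
    | zero => simp [raneyCount]
    | succ r ihr =>
      have h1 := ihm (p + 1 + r)
      rw [show (p + 1) * m + p + (p + 1 + r) = (p + 1) * (m + 1) + p + r by ring] at h1
      rw [raneyCount_succ_succ, ← add_assoc _ r 1, Nat.choose_succ_succ]
      have h2 := Nat.choose_succ_right_eq ((p + 1) * (m + 1) + p + r) m
      rw [show (p + 1) * (m + 1) + p + r - m = p * (m + 2) + r + 1 by
        rw [Nat.sub_eq_iff_eq_add (by nlinarith)]; ring] at h2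
      apply Nat.eq_of_mul_eq_mul_left (Nat.succ_pos m)
      zify at *
      linear_combination (m + 1 : ℤ) * ihr + (m + 2 : ℤ) * h1 - h2

/-- The closed form of the Raney numbers. -/
theorem raneyCount_eq (p m r : ℕ) :
    (raneyCount (p + 1) m (r + 1) : ℚ) =
      (r + 1) / (p * m + r + 1) * ((p + 1) * m + r).choose m := by
  cases m with
  | zero =>
    have : (r + 1 : ℚ) ≠ 0 := by positivity
    simp [raneyCount, this]
  | succ m =>
    have h1 := succ_mul_raneyCount p m (r + 1)
    rw [show (p + 1) * m + p + (r + 1) = (p + 1) * (m + 1) + r by ring] at h1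
    have h2 := Nat.choose_succ_right_eq ((p + 1) * (m + 1) + r) m
    rw [show (p + 1) * (m + 1) + r - m = p * (m + 1) + r + 1 by
      rw [Nat.sub_eq_iff_eq_add (by nlinarith)]; ring] at h2
    have hD : (p * (m + 1 : ℕ) + r + 1 : ℚ) ≠ 0 := by positivity
    have hm : (m + 1 : ℚ) ≠ 0 := by positivity
    rw [div_mul_eq_mul_div, eq_div_iff hD]
    apply mul_left_cancel₀ hm
    qify at h1 h2
    push_cast
    linear_combination (p * (m + 1) + r + 1 : ℚ) * h1 - (r + 1 : ℚ) * h2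

/-- The `(k, l)`-extended Motzkin paths of length `n` ending at height `l`. -/
def motzkinPaths (k : ℕ) : (n : ℕ) → ℕ → Finset (Fin (n + 1) → ℤ)
  | 0, l => if l = 0 then {0} else ∅
  | n + 1, l => (Finset.range (k + l)).biUnion fun j =>
      (motzkinPaths k n j).image fun y => Fin.snoc (α := fun _ => ℤ) y (l : ℤ)

theorem mem_motzkinPaths {k n l : ℕ} {y : Fin (n + 1) → ℤ} :
    y ∈ motzkinPaths k n l ↔ y 0 = 0 ∧ (∀ i, 0 ≤ y i) ∧
      (∀ i : Fin n, y i.succ - y i.castSucc ≥ -((k : ℤ) - 1)) ∧ y (Fin.last n) = l := by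
  induction n generalizing l with
  | zero =>
    by_cases hl : l = 0
    · subst hl
      simp +contextual [motzkinPaths, funext_iff, Fin.forall_fin_one]
    · simp only [motzkinPaths, hl, if_false, Finset.notMem_empty, false_iff]
      rintro ⟨h0, -, -, hlast⟩
      have : y (Fin.last 0) = 0 := h0
      omega
  | succ n ih =>
    simp only [motzkinPaths, Finset.mem_biUnion, Finset.mem_range, Finset.mem_image]
    constructor
    · rintro ⟨j, hj, z, hz, rfl⟩
      obtain ⟨h0, hpos, hstep, hlast⟩ := ih.1 hz
      refine ⟨?_, ?_, ?_, by simp⟩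
      · rw [← Fin.castSucc_zero, Fin.snoc_castSucc, h0]
      · intro i
        induction i using Fin.lastCases with
        | last => simp
        | cast i => simpa using hpos i
      · intro i
        induction i using Fin.lastCases with
        | last => rw [Fin.succ_last, Fin.snoc_last, Fin.snoc_castSucc, hlast]; omega
        | cast i => rw [Fin.succ_castSucc, Fin.snoc_castSucc, Fin.snoc_castSucc]; exact hstep i
    · rintro ⟨h0, hpos, hstep, hlast⟩
      have hlast_step := hstep (Fin.last n)
      have hlast_pos := hpos (Fin.last n).castSucc
      rw [Fin.succ_last, hlast] at hlast_step
      refine ⟨(y (Fin.last n).castSucc).toNat, by omega, Fin.init y,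
        ih.2 ⟨h0, fun i => hpos _, fun i => hstep i.castSucc, ?_⟩, ?_⟩
      · rw [Int.toNat_of_nonneg hlast_pos]; rfl
      · rw [← hlast]; exact Fin.snoc_init_self y

theorem card_motzkinPaths_succ (k n l : ℕ) :
    (motzkinPaths k (n + 1) l).card =
      ∑ j ∈ Finset.range (k + l), (motzkinPaths k n j).card := by
  rw [motzkinPaths, Finset.card_biUnion]
  · refine Finset.sum_congr rfl fun j _ => Finset.card_image_of_injective _ fun y z h => ?_
    simpa using congrArg (Fin.init (α := fun _ => ℤ)) h
  · intro i _ j _ hij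
    rw [Function.onFun, Finset.disjoint_left]
    simp only [Finset.mem_image, not_exists, not_and]
    rintro _ ⟨y, hy, rfl⟩ z hz h
    obtain rfl : z = y := by simpa using congrArg (Fin.init (α := fun _ => ℤ)) h
    have hi := (mem_motzkinPaths.1 hy).2.2.2
    have hj := (mem_motzkinPaths.1 hz).2.2.2
    omega

theorem card_motzkinPaths {k : ℕ} (hk : 1 ≤ k) (n l : ℕ) :
    (motzkinPaths k (n + 1) l).card = raneyCount k n (k + l) := by
  induction n generalizing l with
  | zero =>
    rw [card_motzkinPaths_succ]
    simp only [motzkinPaths, apply_ite Finset.card, Finset.card_singleton, Finset.card_empty]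
    rw [Finset.sum_ite_eq', if_pos (Finset.mem_range.2 (by omega))]
    rfl
  | succ n ih => simp only [card_motzkinPaths_succ k (n + 1), ih, raneyCount]

/-- the number of (k,l)-extended Motzkin paths of length n ending
at height l equals the Raney number
R_{n-1}^{(k,k+l)} = ((k+l)/((k−1)(n−1)+k+l))·binom(kn+l−1, n−1). -/
theorem count_extended_motzkin_paths_ending_at_l (k l n : ℕ) (hk : 2 ≤ k)
    (hl1 : 1 ≤ l) (hl2 : l ≤ k - 2) (hn : 1 ≤ n) :
    (Set.ncard {y : Fin (n + 1) → ℤ | y 0 = 0 ∧ (∀ i, 0 ≤ y i) ∧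
        (∀ i : Fin n, y i.succ - y i.castSucc ≥ -((k : ℤ) - 1)) ∧
        y (Fin.last n) = l} : ℚ) =
      ((k + l : ℚ) / (((k : ℚ) - 1) * ((n : ℚ) - 1) + k + l)) *
        Nat.choose (k * n + l - 1) (n - 1) := by
  obtain ⟨p, rfl⟩ : ∃ p, k = p + 1 := ⟨k - 1, by omega⟩
  obtain ⟨m, rfl⟩ : ∃ m, n = m + 1 := ⟨n - 1, by omega⟩
  have hset : {y : Fin (m + 1 + 1) → ℤ | y 0 = 0 ∧ (∀ i, 0 ≤ y i) ∧
      (∀ i : Fin (m + 1), y i.succ - y i.castSucc ≥ -(((p + 1 : ℕ) : ℤ) - 1)) ∧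
      y (Fin.last (m + 1)) = l} = ↑(motzkinPaths (p + 1) (m + 1) l) := by
    ext y
    rw [Finset.mem_coe, mem_motzkinPaths, Set.mem_ofPred_eq]
  rw [hset, Set.ncard_coe_finset, card_motzkinPaths (by omega),
    show p + 1 + l = p + l + 1 by ring, raneyCount_eq,
    show (p + 1) * (m + 1) + l - 1 = (p + 1) * m + (p + l) by
      rw [Nat.sub_eq_iff_eq_add (by nlinarith)]; ring, Nat.add_sub_cancel]
  push_cast
  congr 2 <;> ring
end

section
/- For every integer n ≥ 1, the number of Motzkin-like n-paths with arbitrarily long up steps — that is, the number of sequences (y_0, …, y_n) of integers with y_0 = 0, y_n = 0, y_i ≥ 0 for all i, and y_i − y_{i−1} ≥ −1 for all 1 ≤ i ≤ n — equals the Catalan number C_n = (1/(n+1))·binom(2n, n). -/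
/-- The height sequences with steps at least `-1` that start at `k`, stay nonnegative and end
at `0` after `n` steps, built by prepending one height at a time. -/
def longUpPaths : (n : ℕ) → ℕ → Finset (Fin (n + 1) → ℤ)
  | 0, k => if k = 0 then {fun _ => 0} else ∅
  | n + 1, k => (Finset.range (n + 2 - max k 1)).biUnion fun i =>
      (longUpPaths n (n - i)).image fun z => (Fin.cons (k : ℤ) z : Fin (n + 2) → ℤ)

theorem head_le_of_neg_one_le_step {n : ℕ} (y : Fin (n + 1) → ℤ) (hlast : y (Fin.last n) = 0)
    (hstep : ∀ i : Fin n, y i.succ - y i.castSucc ≥ -1) : y 0 ≤ n := by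
  induction n with
  | zero => exact hlast.le
  | succ n ih =>
    have h := ih (Fin.tail y) hlast fun i => hstep i.succ
    have h0 := hstep 0
    simp only [Fin.tail, Fin.castSucc_zero] at h h0
    push_cast
    linarith

theorem mem_longUpPaths {n k : ℕ} {y : Fin (n + 1) → ℤ} :
    y ∈ longUpPaths n k ↔ y 0 = k ∧ y (Fin.last n) = 0 ∧ (∀ i, 0 ≤ y i) ∧
      ∀ i : Fin n, y i.succ - y i.castSucc ≥ -1 := by
  induction n generalizing k with
  | zero =>
    rw [longUpPaths]
    split_ifs with hk
    · subst hk
      simp only [Finset.mem_singleton]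
      constructor
      · rintro rfl
        exact ⟨rfl, rfl, fun _ => le_rfl, fun i => i.elim0⟩
      · rintro ⟨h0, -⟩
        ext i
        rwa [show i = 0 from Subsingleton.elim (α := Fin 1) i 0]
    · simp only [Finset.notMem_empty, false_iff]
      rintro ⟨h0, h1, -⟩
      have h1' : y 0 = 0 := h1
      omega
  | succ n ih =>
    simp only [longUpPaths, Finset.mem_biUnion, Finset.mem_range, Finset.mem_image]
    constructor
    · rintro ⟨i, hi, z, hz, rfl⟩
      obtain ⟨h0, hlast, hnonneg, hstep⟩ := ih.1 hz
      refine ⟨rfl, hlast, Fin.cases (by simp) hnonneg, Fin.cases ?_ hstep⟩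
      simp only [Fin.castSucc_zero, Fin.cons_succ, Fin.cons_zero, h0]
      omega
    · rintro ⟨h0, hlast, hnonneg, hstep⟩
      have hle := head_le_of_neg_one_le_step (Fin.tail y) hlast fun i => hstep i.succ
      have hpos := hnonneg (Fin.succ 0)
      have hfirst := hstep 0
      simp only [Fin.tail, Fin.castSucc_zero] at hle hfirst
      refine ⟨n - (y (Fin.succ 0)).toNat, by omega, Fin.tail y, ih.2 ⟨?_, hlast,
        fun i => hnonneg i.succ, fun i => hstep i.succ⟩, ?_⟩
      · simp only [Fin.tail]
        omega
      · rw [← h0]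
        exact Fin.cons_self_tail y

theorem card_longUpPaths_succ (n k : ℕ) :
    (longUpPaths (n + 1) k).card =
      ∑ i ∈ Finset.range (n + 2 - max k 1), (longUpPaths n (n - i)).card := by
  rw [longUpPaths, Finset.card_biUnion]
  · exact Finset.sum_congr rfl fun i _ =>
      Finset.card_image_of_injective _ (Fin.cons_right_injective (α := fun _ => ℤ) _)
  · intro i hi j hj hij
    rw [Function.onFun, Finset.disjoint_left]
    simp only [Finset.mem_image]
    rintro _ ⟨z, hz, rfl⟩ ⟨w, hw, hwz⟩
    obtain rfl := Fin.cons_right_injective (α := fun _ => ℤ) _ hwz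
    have hz0 := (mem_longUpPaths.1 hz).1
    have hw0 := (mem_longUpPaths.1 hw).1
    simp only [Finset.coe_range, Set.mem_Iio] at hi hj
    omega

theorem sum_range_mul_choose_add (n d : ℕ) :
    ((n : ℚ) + 2) * ∑ i ∈ Finset.range (d + 1), ((n : ℚ) - i + 1) * (n + i).choose n =
      (n + 1) * (n - d + 2) * (n + 1 + d).choose (n + 1) := by
  induction d with
  | zero => simp; ring
  | succ d ih =>
    rw [Finset.sum_range_succ, mul_add, ih]
    have h1 : (n + 1 + (d + 1)).choose (n + 1) =
        (n + (d + 1)).choose n + (n + 1 + d).choose (n + 1) := by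
      rw [show n + 1 + (d + 1) = (n + (d + 1)) + 1 by ring, Nat.choose_succ_succ,
        show n + (d + 1) = n + 1 + d by ring]
    have h2 : ((n + 1 + d).choose (n + 1) : ℚ) * (n + 1) = (n + (d + 1)).choose n * (d + 1) := by
      have h := Nat.choose_succ_right_eq (n + 1 + d) n
      rw [show n + 1 + d - n = d + 1 by omega] at h
      rw [show n + (d + 1) = n + 1 + d by ring]
      exact_mod_cast h
    rw [h1]
    push_cast
    linear_combination h2

theorem card_longUpPaths {n i : ℕ} (hi : i ≤ n) :
    ((n : ℚ) + 1) * (longUpPaths n (n - i)).card = (n - i + 1) * (n + i).choose n := by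
  induction n generalizing i with
  | zero =>
    obtain rfl : i = 0 := by omega
    simp [longUpPaths]
  | succ n ih =>
    have key (d : ℕ) (hd : d ≤ n) :
        ((n : ℚ) + 2) * ∑ j ∈ Finset.range (d + 1), ((longUpPaths n (n - j)).card : ℚ) =
          (n - d + 2) * (n + 1 + d).choose (n + 1) := by
      have hn : (n : ℚ) + 1 ≠ 0 := by positivity
      apply mul_left_cancel₀ hn
      rw [← mul_assoc ((n : ℚ) + 1) (n - d + 2), ← sum_range_mul_choose_add, mul_left_comm,
        Finset.mul_sum]
      congr 1
      refine Finset.sum_congr rfl fun j hj => ih ?_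
      rw [Finset.mem_range] at hj
      omega
    rw [card_longUpPaths_succ]
    push_cast
    rcases hi.eq_or_lt with rfl | hlt
    · rw [show n + 2 - max (n + 1 - (n + 1)) 1 = n + 1 by omega]
      have h : (n + 1 + (n + 1)).choose (n + 1) = 2 * (n + 1 + n).choose (n + 1) := by
        have hs : (n + 1 + n).choose n = (n + 1 + n).choose (n + 1) :=
          Nat.choose_symm_of_eq_add (by ring)
        rw [← add_assoc, Nat.choose_succ_succ, hs]
        ring
      rw [h]
      push_cast
      linear_combination key n le_rfl
    · rw [show n + 2 - max (n + 1 - i) 1 = i + 1 by omega]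
      linear_combination key i (by omega)

/-- Motzkin-like n-paths with arbitrarily long up steps are counted
by the Catalan number C_n = (1/(n+1))·binom(2n, n). -/
theorem count_long_up_motzkin_paths (n : ℕ) (hn : 1 ≤ n) :
    (Set.ncard {y : Fin (n + 1) → ℤ | y 0 = 0 ∧ y (Fin.last n) = 0 ∧
        (∀ i, 0 ≤ y i) ∧
        (∀ i : Fin n, y i.succ - y i.castSucc ≥ -1)} : ℚ) =
      (1 / ((n : ℚ) + 1)) * Nat.choose (2 * n) n := by
  have hset : {y : Fin (n + 1) → ℤ | y 0 = 0 ∧ y (Fin.last n) = 0 ∧ (∀ i, 0 ≤ y i) ∧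
      (∀ i : Fin n, y i.succ - y i.castSucc ≥ -1)} = longUpPaths n 0 := by
    ext y
    rw [Finset.mem_coe, mem_longUpPaths]
    simp
  rw [hset, Set.ncard_coe_finset]
  have h := card_longUpPaths (le_refl n)
  rw [Nat.sub_self, ← two_mul] at h
  field_simp
  linear_combination h
end

section
/- Let k, l, n be integers with k ≥ 2, l ≥ 1 and n ≥ 1. Then R_n^{(k,l+1)} − R_n^{(k,l)} = R_{n−1}^{(k,k+l)}, i.e., ((l+1)/(kn+l+1))·binom(kn+l+1, n) − (l/(kn+l))·binom(kn+l, n) = ((k+l)/((k−1)(n−1)+k+l))·binom(kn+l−1, n−1). -/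
/-- R_n^{(k,l+1)} − R_n^{(k,l)} = R_{n−1}^{(k,k+l)}, i.e.
((l+1)/(kn+l+1))·binom(kn+l+1, n) − (l/(kn+l))·binom(kn+l, n)
  = ((k+l)/((k−1)(n−1)+k+l))·binom(kn+l−1, n−1). -/
theorem raney_difference (k l n : ℕ) (hk : 2 ≤ k) (hl : 1 ≤ l) (hn : 1 ≤ n) :
    ((l + 1 : ℚ) / (k * n + l + 1)) * Nat.choose (k * n + l + 1) n -
      ((l : ℚ) / (k * n + l)) * Nat.choose (k * n + l) n =
      ((k + l : ℚ) / (((k : ℚ) - 1) * ((n : ℚ) - 1) + k + l)) *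
        Nat.choose (k * n + l - 1) (n - 1) := by
  obtain ⟨m, rfl⟩ := Nat.exists_eq_add_of_le' hn
  obtain ⟨M, hM⟩ : ∃ M, k * (m + 1) + l = M + 1 := Nat.exists_eq_add_of_le' (by omega)
  have hmM : m ≤ M := by nlinarith
  have hMQ : (k : ℚ) * (m + 1) + l = M + 1 := by exact_mod_cast hM
  have hmQ : (m : ℚ) ≤ M := by exact_mod_cast hmM
  have h₁ : ((M : ℚ) + 1) * M.choose m = (M + 1).choose (m + 1) * (m + 1) := by
    exact_mod_cast Nat.add_one_mul_choose_eq M m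
  have h₂ : ((M : ℚ) + 1 + 1) * (M + 1).choose m =
      (M + 1 + 1).choose (m + 1) * (m + 1) := by
    exact_mod_cast Nat.add_one_mul_choose_eq (M + 1) m
  have h₃ : (M.choose m : ℚ) * (M + 1) = (M + 1).choose m * (M + 1 - m) := by
    have h := congrArg (Nat.cast (R := ℚ)) (Nat.choose_mul_succ_eq M m)
    push_cast [Nat.cast_sub (show m ≤ M + 1 by omega)] at h
    exact h
  have hm0 : (m : ℚ) + 1 ≠ 0 := by positivity
  have hM0 : (M : ℚ) + 1 ≠ 0 := by positivity
  have hM1 : (M : ℚ) + 1 + 1 ≠ 0 := by positivity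
  have hd : (M : ℚ) + 1 - m ≠ 0 := by linarith
  have hden : ((k : ℚ) - 1) * ((m : ℚ) + 1 - 1) + k + l = M + 1 - m := by
    linear_combination hMQ
  rw [hM]
  push_cast
  rw [hden, hMQ, eq_div_of_mul_eq hm0 h₂.symm,
    eq_div_of_mul_eq hm0 h₁.symm, eq_div_of_mul_eq hd h₃.symm]
  field_simp
  linear_combination -(M.choose m : ℚ) * hMQ
end
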